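/- Let k ≥ 1, let X : Ω → ℝ^k (the vector of parent variables) and E : Ω → ℝ be measurable with X and E independent under every P^e. Let f : ℝ^k → ℝ → ℝ be jointly measurable such that each f x is a C¹ diffeomorphism of ℝ, and set Y := (ω ↦ f (X ω) (E ω)). Suppose for each e that (P^e).map E = volume.withDensity p^e for a measurable density p^e : ℝ → ℝ≥0, with the positivity condition ∑_e p^e(t) > 0 for every t ∈ ℝ. Define q^e(x, y) := p^e((f x)⁻¹(y)) · |deriv (f x)⁻¹ (y)| and Γ : Ω → ℝ^m by Γ(ω)_e := q^e(X ω, Y ω) / ∑_{e'} q^{e'}(X ω, Y ω). Then for every e, the random variables Γ and X are independent under P^e. -/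

import Mathlib

open MeasureTheory ProbabilityTheory
open scoped ENNReal NNReal

/-- A C¹ diffeomorphism of `ℝ`: a bijection that is continuously differentiable
with continuously differentiable inverse. -/
def IsC1Diffeo (g : ℝ → ℝ) : Prop :=
  Function.Bijective g ∧ ContDiff ℝ 1 g ∧ ContDiff ℝ 1 (Function.invFun g)

/-- The inverse of a C¹ diffeomorphism of `ℝ` has nowhere vanishing derivative. -/
theorem IsC1Diffeo.deriv_invFun_ne_zero {g : ℝ → ℝ} (hg : IsC1Diffeo g) (y : ℝ) :
    deriv (Function.invFun g) y ≠ 0 := by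
  obtain ⟨hbij, hg, hinv⟩ := hg
  have hcomp := ((hg.differentiable one_ne_zero) _).hasDerivAt.comp y
    ((hinv.differentiable one_ne_zero) y).hasDerivAt
  have hid : g ∘ Function.invFun g = id :=
    (Function.rightInverse_invFun hbij.surjective).comp_eq_id
  rw [hid] at hcomp
  exact right_ne_zero_of_mul_eq_one (hcomp.unique (hasDerivAt_id y))

/-- Main theorem (positive form), multivariate case: the cause is the vector
`X : Ω → ℝᵏ` of parent variables. In the model `Y = f (X, E)` with `X ⫫ E` in every
domain, each fixed-cause functional `f x` a C¹ diffeomorphism of `ℝ`, and the noise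
having Lebesgue densities `p e` with `∑ₑ p e t > 0` everywhere, the statistic
`Γ(ω)ₑ = qᵉ(Xω, Yω) / ∑ₑ' qᵉ'(Xω, Yω)` — where
`qᵉ(x, y) = pᵉ((f x)⁻¹ y) · |deriv (f x)⁻¹ y|` — is independent of `X` in every
domain. -/
theorem gamma_indep_of_bgm_multivariate {Ω : Type*} [MeasurableSpace Ω]
    (m k : ℕ) (hm : 1 ≤ m) (hk : 1 ≤ k)
    (P : Fin m → Measure Ω) (hP : ∀ e, IsProbabilityMeasure (P e))
    (X : Ω → (Fin k → ℝ)) (E : Ω → ℝ) (hX : Measurable X) (hE : Measurable E)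
    (hindep : ∀ e : Fin m, IndepFun X E (P e))
    (f : (Fin k → ℝ) → ℝ → ℝ) (hf : Measurable (Function.uncurry f))
    (hdiff : ∀ x, IsC1Diffeo (f x))
    (Y : Ω → ℝ) (hY : Y = fun ω => f (X ω) (E ω))
    (p : Fin m → ℝ → ℝ≥0) (hp : ∀ e, Measurable (p e))
    (hd : ∀ e, (P e).map E = volume.withDensity (fun t => (p e t : ℝ≥0∞)))
    (hpos : ∀ t : ℝ, 0 < ∑ e : Fin m, (p e t : ℝ))
    (q : Fin m → (Fin k → ℝ) → ℝ → ℝ)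
    (hq : ∀ (e : Fin m) (x : Fin k → ℝ) (y : ℝ),
      q e x y = (p e (Function.invFun (f x) y) : ℝ) * |deriv (Function.invFun (f x)) y|)
    (Γ : Ω → Fin m → ℝ)
    (hΓ : Γ = fun ω => fun e => q e (X ω) (Y ω) / ∑ e' : Fin m, q e' (X ω) (Y ω)) :
    ∀ e : Fin m, IndepFun Γ X (P e) := by
  intro e
  have hΓE : Γ = (fun t e => (p e t : ℝ) / ∑ e' : Fin m, (p e' t : ℝ)) ∘ E := by
    funext ω e
    simp only [hΓ, hY, hq, Function.comp_apply,
      Function.leftInverse_invFun (hdiff (X ω)).1.injective (E ω), ← Finset.sum_mul]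
    exact mul_div_mul_right _ _ (abs_ne_zero.2 ((hdiff (X ω)).deriv_invFun_ne_zero _))
  rw [hΓE]
  refine (hindep e).symm.comp (measurable_pi_lambda _ fun e => ?_) measurable_id
  exact (hp e).coe_nnreal_real.div (Finset.measurable_sum _ fun e' _ => (hp e').coe_nnreal_real)
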